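/- arXiv:2408.01139 — 2 statements merged into one kernel-verified Lean document; each statement's English description precedes it below -/
import Mathlib

section
/- Let I be a finite set of players with |I| = M ≥ 1 and let v : Finset I → ℝ satisfy v(∅) = 0. Then the Shapley values satisfy efficiency: Σ_{i∈I} ψ_i(v) = v(I), where ψ_i(v) = Σ_{S ⊆ I \ {i}} (1/M) · C(M−1, |S|)^{-1} · (v(S ∪ {i}) − v(S)). -/
open Finset

/-- Double counting of pairs `(i, S)` with `i ∉ S`, indexed by the coalition `S`. -/
lemma sum_powerset_erase_eq_card_compl_mul {I : Type*} [Fintype I] [DecidableEq I]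
    (f : Finset I → ℝ) :
    ∑ i : I, ∑ S ∈ ((univ : Finset I).erase i).powerset, f S =
      ∑ T : Finset I, ((Fintype.card I : ℝ) - #T) * f T := by
  rw [sum_comm' (t' := univ) (s' := fun T => Tᶜ)]
  · refine sum_congr rfl fun T _ => ?_
    rw [sum_const, nsmul_eq_mul, card_compl, Nat.cast_sub (card_le_univ T)]
  · simp [subset_erase]

/-- Double counting of pairs `(i, S)` with `i ∉ S`, indexed by the coalition `insert i S`. -/
lemma sum_powerset_erase_insert_eq_card_mul {I : Type*} [Fintype I] [DecidableEq I]
    (w : ℕ → ℝ) (v : Finset I → ℝ) :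
    ∑ i : I, ∑ S ∈ ((univ : Finset I).erase i).powerset, w #S * v (insert i S) =
      ∑ T : Finset I, (#T : ℝ) * (w (#T - 1) * v T) := by
  have key (i : I) : ∑ S ∈ ((univ : Finset I).erase i).powerset, w #S * v (insert i S) =
      ∑ T : Finset I with i ∈ T, w (#T - 1) * v T := by
    refine sum_bij' (fun S _ => insert i S) (fun T _ => T.erase i) ?_ ?_ ?_ ?_ ?_
    · simp
    · simp [subset_erase]
    · intro S hS
      exact erase_insert (by simpa [subset_erase] using hS)
    · intro T hT
      exact insert_erase (by simpa using hT)
    · intro S hS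
      have hi : i ∉ S := by simpa [subset_erase] using hS
      simp [card_insert_of_notMem hi]
  simp_rw [key]
  rw [sum_comm' (t' := univ) (s' := fun T => T)]
  · simp
  · simp

/-- The Shapley weights telescope across consecutive coalition sizes. -/
lemma succ_mul_inv_choose_eq {m j : ℕ} (hj : j < m) :
    ((j : ℝ) + 1) * ((m.choose j : ℝ))⁻¹ = ((m : ℝ) - j) * ((m.choose (j + 1) : ℝ))⁻¹ := by
  have h := congrArg (Nat.cast (R := ℝ)) (Nat.choose_succ_right_eq m j)
  push_cast [Nat.cast_sub hj.le] at h
  have h₀ : (m.choose j : ℝ) ≠ 0 := by exact_mod_cast (Nat.choose_pos hj.le).ne'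
  have h₁ : (m.choose (j + 1) : ℝ) ≠ 0 := by exact_mod_cast (Nat.choose_pos hj).ne'
  field_simp
  linarith

/-- Efficiency axiom of the Shapley value: the Shapley values of all players
sum to the worth of the grand coalition. -/
theorem shapley_efficiency
    {I : Type*} [Fintype I] [DecidableEq I]
    (M : ℕ) (hM : 1 ≤ M) (hcard : Fintype.card I = M)
    (v : Finset I → ℝ) (hv : v ∅ = 0) :
    ∑ i : I, (∑ S ∈ ((Finset.univ : Finset I).erase i).powerset,
        (1 / (M : ℝ)) * (((M - 1).choose S.card : ℝ))⁻¹ * (v (insert i S) - v S))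
      = v Finset.univ := by
  obtain ⟨m, rfl⟩ : ∃ m, M = m + 1 := ⟨M - 1, by omega⟩
  simp_rw [mul_sub, sum_sub_distrib]
  rw [sum_powerset_erase_insert_eq_card_mul
      (fun k => 1 / ((m + 1 : ℕ) : ℝ) * (((m + 1 - 1).choose k : ℝ))⁻¹) v,
    sum_powerset_erase_eq_card_compl_mul, ← sum_sub_distrib, hcard,
    sum_eq_single_of_mem univ (mem_univ _)]
  · have hm : (m : ℝ) + 1 ≠ 0 := by positivity
    simp [hcard, hm]
  · intro T _ hT
    rcases T.eq_empty_or_nonempty with rfl | hne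
    · simp [hv]
    · have hlt : #T < m + 1 := hcard ▸ (card_lt_iff_ne_univ T).2 hT
      obtain ⟨j, hj⟩ : ∃ j, #T = j + 1 := ⟨#T - 1, by have := hne.card_pos; omega⟩
      have h := succ_mul_inv_choose_eq (m := m) (j := j) (by omega)
      simp only [hj, Nat.add_sub_cancel]
      push_cast
      linear_combination (1 / ((m : ℝ) + 1) * v T) * h
end

section
/- Let I be a finite nonempty set of players with |I| = M, and let φ assign to every characteristic function v : Finset I → ℝ with v(∅) = 0 a vector (φ_i(v))_{i∈I} ∈ ℝ^I satisfying: (efficiency) Σ_{i∈I} φ_i(v) = v(I); (symmetry) if v(S ∪ {i}) = v(S ∪ {j}) for all S ⊆ I \ {i, j}, then φ_i(v) = φ_j(v); (additivity) φ_i(u + v) = φ_i(u) + φ_i(v) for all such games u, v and all i; and (dummy player) if v(S ∪ {i}) = v(S) for all S ⊆ I \ {i}, then φ_i(v) = 0. Then for every v with v(∅) = 0 and every i ∈ I, φ_i(v) = ψ_i(v) = Σ_{S ⊆ I \ {i}} (1/M) · C(M−1, |S|)^{-1} · (v(S ∪ {i}) − v(S)). -/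
open Finset

/-- An additive assignment commutes with finite sums of games. -/
theorem value_sum_of_additive {I ι : Type*} (φ : (Finset I → ℝ) → I → ℝ)
    (hadd : ∀ u v : Finset I → ℝ, u ∅ = 0 → v ∅ = 0 → ∀ i : I, φ (u + v) i = φ u i + φ v i)
    (s : Finset ι) (f : ι → Finset I → ℝ) (hf : ∀ a ∈ s, f a ∅ = 0) (i : I) :
    φ (∑ a ∈ s, f a) i = ∑ a ∈ s, φ (f a) i := by
  classical
  induction s using Finset.induction_on with
  | empty => simpa using hadd 0 0 rfl rfl i
  | insert a s ha ih =>
    have hs : ∀ b ∈ s, f b ∅ = 0 := fun b hb => hf b (mem_insert_of_mem hb)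
    rw [sum_insert ha, sum_insert ha, hadd _ _ (hf a (mem_insert_self a s)) _ i, ih hs]
    rw [Finset.sum_apply]
    exact sum_eq_zero hs

/-- A one-coalition game supported on a nonempty coalition vanishes at the empty coalition. -/
theorem single_apply_empty {I : Type*} [DecidableEq I] {S : Finset I} (hS : S.Nonempty) (c : ℝ) :
    (Pi.single S c : Finset I → ℝ) ∅ = 0 := by
  simp [hS.ne_empty.symm]

/-- Moving a nonmember into the coalition supporting a one-coalition game negates its value. -/
theorem value_single_eq_neg_of_notMem {I : Type*} [Fintype I] [DecidableEq I]
    (φ : (Finset I → ℝ) → I → ℝ)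
    (hadd : ∀ u v : Finset I → ℝ, u ∅ = 0 → v ∅ = 0 → ∀ i : I, φ (u + v) i = φ u i + φ v i)
    (hdummy : ∀ v : Finset I → ℝ, v ∅ = 0 → ∀ i : I,
      (∀ S ∈ ((Finset.univ : Finset I).erase i).powerset, v (insert i S) = v S) → φ v i = 0)
    {S : Finset I} (hS : S.Nonempty) {i : I} (hi : i ∉ S) (c : ℝ) :
    φ (Pi.single S c) i = -φ (Pi.single (insert i S) c) i := by
  have h1 : (Pi.single S c : Finset I → ℝ) ∅ = 0 := single_apply_empty hS c
  have h2 : (Pi.single (insert i S) c : Finset I → ℝ) ∅ = 0 :=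
    single_apply_empty (insert_nonempty i S) c
  rw [eq_neg_iff_add_eq_zero, ← hadd _ _ h1 h2]
  refine hdummy _ (by simp [h1]) i fun T hT => ?_
  have hiT : i ∉ T := fun h => by simpa using mem_powerset.1 hT h
  have e1 : insert i T ≠ S := fun h => hi (h ▸ mem_insert_self i T)
  have e2 : T ≠ insert i S := fun h => hiT (h ▸ mem_insert_self i S)
  have e3 : insert i T = insert i S ↔ T = S :=
    ⟨fun h => by rw [← erase_insert hiT, h, erase_insert hi], fun h => h ▸ rfl⟩
  simp [Pi.single_apply, e1, e2, e3]

/-- The members of the coalition supporting a one-coalition game have equal values. -/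
theorem value_single_eq_of_mem {I : Type*} [Fintype I] [DecidableEq I]
    (φ : (Finset I → ℝ) → I → ℝ)
    (hsym : ∀ v : Finset I → ℝ, v ∅ = 0 → ∀ i j : I,
      (∀ S ∈ ((Finset.univ : Finset I) \ {i, j}).powerset,
        v (insert i S) = v (insert j S)) → φ v i = φ v j)
    {S : Finset I} {i j : I} (hi : i ∈ S) (hj : j ∈ S) (c : ℝ) :
    φ (Pi.single S c) i = φ (Pi.single S c) j := by
  rcases eq_or_ne i j with rfl | hij
  · rfl
  refine hsym _ (single_apply_empty ⟨i, hi⟩ c) i j fun T hT => ?_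
  have hiT : i ∉ T := fun h => by simpa using mem_powerset.1 hT h
  have hjT : j ∉ T := fun h => by simpa using mem_powerset.1 hT h
  have e1 : insert i T ≠ S := fun h => by
    rw [← h, mem_insert] at hj
    exact hj.elim hij.symm hjT
  have e2 : insert j T ≠ S := fun h => by
    rw [← h, mem_insert] at hi
    exact hi.elim hij hiT
  rw [Pi.single_eq_of_ne e1, Pi.single_eq_of_ne e2]

/-- The value of a member in a one-coalition game. -/
theorem value_single_insert {I : Type*} [Fintype I] [DecidableEq I]
    (φ : (Finset I → ℝ) → I → ℝ)
    (heff : ∀ v : Finset I → ℝ, v ∅ = 0 → ∑ i : I, φ v i = v Finset.univ)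
    (hsym : ∀ v : Finset I → ℝ, v ∅ = 0 → ∀ i j : I,
      (∀ S ∈ ((Finset.univ : Finset I) \ {i, j}).powerset,
        v (insert i S) = v (insert j S)) → φ v i = φ v j)
    (hadd : ∀ u v : Finset I → ℝ, u ∅ = 0 → v ∅ = 0 → ∀ i : I, φ (u + v) i = φ u i + φ v i)
    (hdummy : ∀ v : Finset I → ℝ, v ∅ = 0 → ∀ i : I,
      (∀ S ∈ ((Finset.univ : Finset I).erase i).powerset, v (insert i S) = v S) → φ v i = 0)
    (c : ℝ) {S : Finset I} {i : I} (hi : i ∉ S) :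
    φ (Pi.single (insert i S) c) i =
      1 / (Fintype.card I : ℝ) * ((Fintype.card I - 1).choose #S : ℝ)⁻¹ * c := by
  obtain ⟨n, hn⟩ : ∃ n, Fintype.card I = #S + 1 + n := by
    refine Nat.exists_eq_add_of_le ?_
    rw [← card_insert_of_notMem hi]
    exact card_le_univ _
  induction n generalizing S i with
  | zero =>
    have hU : insert i S = univ := by
      rw [← card_eq_iff_eq_univ, card_insert_of_notMem hi, hn, add_zero]
    have h := heff (Pi.single (insert i S) c)
      (single_apply_empty (insert_nonempty i S) c)
    rw [sum_congr rfl fun j _ => value_single_eq_of_mem φ hsym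
      (hU ▸ mem_univ j : j ∈ insert i S) (mem_insert_self i S) c, ← hU, Pi.single_eq_same,
      sum_const, card_insert_of_notMem hi, nsmul_eq_mul] at h
    rw [hn, add_zero, Nat.add_sub_cancel, Nat.choose_self]
    have hs : ((#S + 1 : ℕ) : ℝ) ≠ 0 := by positivity
    field_simp
    linear_combination h
  | succ n ih =>
    have hcard : #(insert i S) = #S + 1 := card_insert_of_notMem hi
    have hU : univ ≠ insert i S := fun h => by
      rw [← h, card_univ] at hcard
      omega
    have h := heff (Pi.single (insert i S) c)
      (single_apply_empty (insert_nonempty i S) c)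
    have hout : ∀ j ∈ (insert i S)ᶜ, φ (Pi.single (insert i S) c) j =
        -(1 / (Fintype.card I : ℝ) * ((Fintype.card I - 1).choose (#S + 1) : ℝ)⁻¹ * c) := by
      intro j hj
      rw [mem_compl] at hj
      rw [value_single_eq_neg_of_notMem φ hadd hdummy (insert_nonempty i S) hj,
        ih hj (by rw [hcard, hn]; ring), hcard]
    rw [Pi.single_eq_of_ne hU, ← sum_add_sum_compl (insert i S), sum_congr rfl hout,
      sum_congr rfl fun j hj => value_single_eq_of_mem φ hsym hj (mem_insert_self i S) c,
      sum_const, sum_const, card_compl, hcard, hn, Nat.add_sub_cancel_left, nsmul_eq_mul,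
      nsmul_eq_mul, show #S + 1 + (n + 1) - 1 = #S + 1 + n by omega] at h
    have hc := Nat.choose_succ_right_eq (#S + 1 + n) #S
    rw [show #S + 1 + n - #S = n + 1 by omega] at hc
    have hp : ((#S + 1 + n).choose #S : ℝ) ≠ 0 := by
      exact_mod_cast (Nat.choose_pos (by omega)).ne'
    have hq : ((#S + 1 + n).choose (#S + 1) : ℝ) ≠ 0 := by
      exact_mod_cast (Nat.choose_pos (by omega)).ne'
    have hs : ((#S + 1 : ℕ) : ℝ) ≠ 0 := by positivity
    rw [hn, show #S + 1 + (n + 1) - 1 = #S + 1 + n by omega]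
    have hc' : ((#S + 1 + n).choose (#S + 1) : ℝ) * (#S + 1 : ℕ) =
        (#S + 1 + n).choose #S * (n + 1 : ℕ) := by exact_mod_cast hc
    have hM : ((#S + 1 + (n + 1) : ℕ) : ℝ) ≠ 0 := by positivity
    generalize ((#S + 1 + n).choose #S : ℝ) = p at *
    generalize ((#S + 1 + n).choose (#S + 1) : ℝ) = q at *
    generalize ((#S + 1 + (n + 1) : ℕ) : ℝ) = m at *
    generalize ((#S + 1 : ℕ) : ℝ) = s at *
    generalize ((n + 1 : ℕ) : ℝ) = r at *
    field_simp at h ⊢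
    refine mul_left_cancel₀ (mul_ne_zero hq hs) ?_
    linear_combination p * h - c * hc'

/-- Uniqueness of the Shapley value: any assignment `φ` of values to games
(with `v ∅ = 0`) satisfying efficiency, symmetry, additivity and the
dummy-player axiom coincides with the Shapley value. -/
theorem shapley_uniqueness
    {I : Type*} [Fintype I] [DecidableEq I] [Nonempty I]
    (M : ℕ) (hcard : Fintype.card I = M)
    (φ : (Finset I → ℝ) → I → ℝ)
    (heff : ∀ v : Finset I → ℝ, v ∅ = 0 → ∑ i : I, φ v i = v Finset.univ)
    (hsym : ∀ v : Finset I → ℝ, v ∅ = 0 → ∀ i j : I,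
      (∀ S ∈ ((Finset.univ : Finset I) \ {i, j}).powerset,
        v (insert i S) = v (insert j S)) → φ v i = φ v j)
    (hadd : ∀ u v : Finset I → ℝ, u ∅ = 0 → v ∅ = 0 → ∀ i : I,
      φ (u + v) i = φ u i + φ v i)
    (hdummy : ∀ v : Finset I → ℝ, v ∅ = 0 → ∀ i : I,
      (∀ S ∈ ((Finset.univ : Finset I).erase i).powerset, v (insert i S) = v S) →
        φ v i = 0) :
    ∀ v : Finset I → ℝ, v ∅ = 0 → ∀ i : I,
      φ v i = ∑ S ∈ ((Finset.univ : Finset I).erase i).powerset,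
        (1 / (M : ℝ)) * (((M - 1).choose S.card : ℝ))⁻¹ * (v (insert i S) - v S) := by
  intro v hv i
  have hsingle : ∀ T ∈ (univ : Finset (Finset I)), (Pi.single T (v T) : Finset I → ℝ) ∅ = 0 := by
    intro T _
    rcases T.eq_empty_or_nonempty with rfl | hT
    · rw [Pi.single_eq_same, hv]
    · exact single_apply_empty hT _
  have hsum := value_sum_of_additive φ hadd univ (fun T => Pi.single T (v T)) hsingle i
  rw [univ_sum_single, ← powerset_univ, ← insert_erase (mem_univ i),
    sum_powerset_insert (notMem_erase i univ), ← sum_add_distrib] at hsum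
  rw [hsum]
  refine sum_congr rfl fun S hS => ?_
  have hi : i ∉ S := fun h => by simpa using mem_powerset.1 hS h
  have hval := fun c => value_single_insert φ heff hsym hadd hdummy c hi
  rw [hcard] at hval
  have hneg : φ (Pi.single S (v S)) i = -φ (Pi.single (insert i S) (v S)) i := by
    rcases S.eq_empty_or_nonempty with rfl | hne
    · rw [hval, hv, Pi.single_zero, hdummy 0 rfl i fun _ _ => rfl]
      simp
    · exact value_single_eq_neg_of_notMem φ hadd hdummy hne hi _
  rw [hneg, hval, hval]
  ring
end
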